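/- arXiv:2409.13223 — 9 statements merged into one kernel-verified Lean document; each statement's English description precedes it below -/
import Mathlib

section
/- For every pair of one-bit encoding functions E₁, E₂ : {0,1}² → {0,1} and every decoding function D : {0,1} × {0,1} × {0,1}² → {0,1} (taking the two communicated bits c₁ = E₁(x₁⁰,x₁¹), c₂ = E₂(x₂⁰,x₂¹) and Bob's full input string y = (y⁰,y¹)), there exist input strings x₁ = (x₁⁰,x₁¹), x₂ = (x₂⁰,x₂¹), y = (y⁰,y¹) ∈ {0,1}² satisfying the promise x₁⁰ ⊕ x₂⁰ ⊕ y⁰ = 0 such that D(E₁(x₁), E₂(x₂), y) ≠ f₂(x₁, x₂, y). In other words, no deterministic classical strategy in which each of the two senders communicates one bit computes f₂ exactly. -/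
/-- `bitP r = 1` iff `r` is odd (the parity function ℙ). -/
def bitP (r : ℕ) : Bool := r % 2 == 1

/-- The value of a bit as a natural number. -/
def b2n (b : Bool) : ℕ := cond b 1 0

/-- The function `f₂` of the CC₂ task:
`f₂(x₁,x₂,y) = x₁¹ ⊕ x₂¹ ⊕ y¹ ⊕ ℙ[(x₁⁰ + x₂⁰ + y⁰)/2]`. -/
def f2 (x1 x2 y : Bool × Bool) : Bool :=
  xor (xor (xor x1.2 x2.2) y.2) (bitP ((b2n x1.1 + b2n x2.1 + b2n y.1) / 2))

/-- The promise condition `x₁⁰ ⊕ x₂⁰ ⊕ y⁰ = 0`. -/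
abbrev promise2 (x1 x2 y : Bool × Bool) : Prop :=
  xor (xor x1.1 x2.1) y.1 = false

/-- An encoder that separates the two values of the second bit, for each first bit, reaches the
message `false` from every first bit. -/
lemma exists_preimage_false_of_separates {E : Bool × Bool → Bool}
    (hE : ∀ a, E (a, false) ≠ E (a, true)) : ∃ g : Bool → Bool, ∀ a, E (a, g a) = false := by
  refine ⟨fun a => E (a, false), fun a => ?_⟩
  have := hE a
  cases h : E (a, false) <;> simp_all

/-- No output depending on `y` alone computes `f₂` on the inputs `x₁ = (a, g₁ a)`, `x₂ = (b, g₂ b)`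
satisfying the promise. -/
lemma not_forall_f2_eq (g1 g2 d : Bool → Bool) :
    ¬ ∀ a b, d (xor a b) = f2 (a, g1 a) (b, g2 b) (xor a b, false) := by
  intro h
  have h00 := h false false
  have h11 := h true true
  have h01 := h false true
  have h10 := h true false
  revert h00 h11 h01 h10
  simp only [Bool.xor_self, Bool.xor_true, Bool.xor_false, Bool.not_false]
  generalize g1 false = p, g1 true = q, g2 false = r, g2 true = s, d false = u, d true = v
  revert p q r s u v
  decide

/-- No deterministic classical strategy in which each of the two senders
communicates one bit computes `f₂` exactly on all promise inputs. -/
theorem no_one_bit_deterministic_strategy_for_f2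
    (E1 E2 : Bool × Bool → Bool) (D : Bool → Bool → Bool × Bool → Bool) :
    ∃ x1 x2 y : Bool × Bool, promise2 x1 x2 y ∧
      D (E1 x1) (E2 x2) y ≠ f2 x1 x2 y := by
  by_contra! h
  have h1 : ∀ a, E1 (a, false) ≠ E1 (a, true) := fun a he => by
    have hf := h (a, false) (false, false) (a, false) (by simp [promise2])
    have ht := h (a, true) (false, false) (a, false) (by simp [promise2])
    rw [he, ht] at hf
    simp [f2] at hf
  have h2 : ∀ a, E2 (a, false) ≠ E2 (a, true) := fun a he => by
    have hf := h (false, false) (a, false) (a, false) (by simp [promise2])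
    have ht := h (false, false) (a, true) (a, false) (by simp [promise2])
    rw [he, ht] at hf
    simp [f2] at hf
  obtain ⟨g1, hg1⟩ := exists_preimage_false_of_separates h1
  obtain ⟨g2, hg2⟩ := exists_preimage_false_of_separates h2
  refine not_forall_f2_eq g1 g2 (fun c => D false false (c, false)) fun a b => ?_
  simpa only [hg1, hg2] using h (a, g1 a) (b, g2 b) (xor a b, false) (by simp [promise2])
end

section
/- There exist a one-bit encoding function E₂ : {0,1}² → {0,1} and a decoding function D : {0,1}² × {0,1} × {0,1}² → {0,1} such that for all input strings x₁, x₂, y ∈ {0,1}² satisfying the promise x₁⁰ ⊕ x₂⁰ ⊕ y⁰ = 0, one has D(x₁, E₂(x₂), y) = f₂(x₁, x₂, y). That is, f₂ can be evaluated exactly when one sender communicates her full two-bit string and the other sender communicates a single bit. -/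
/-- `f₂` can be evaluated exactly when the first sender communicates her full
two-bit string and the second sender communicates a single bit. -/
theorem f2_computable_with_two_plus_one_bits :
    ∃ (E2 : Bool × Bool → Bool) (D : Bool × Bool → Bool → Bool × Bool → Bool),
      ∀ x1 x2 y : Bool × Bool, promise2 x1 x2 y →
        D x1 (E2 x2) y = f2 x1 x2 y := by
  refine ⟨Prod.snd, fun x1 b y => f2 x1 (xor x1.1 y.1, b) y, ?_⟩
  rintro ⟨a, a'⟩ ⟨b, b'⟩ ⟨c, c'⟩ h
  have hb : xor a c = b := by
    revert h
    cases a <;> cases b <;> cases c <;> simp [promise2]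
  simp only [hb]
end

section
/- Let n ≥ 2 and let i ≠ j be two distinct sender indices in {1, …, n}. For every pair of one-bit encoding functions Eᵢ, Eⱼ : {0,1}² → {0,1}, and every decoding function D taking as inputs the two communicated bits Eᵢ(xᵢ), Eⱼ(xⱼ), the complete two-bit strings xₖ of all other senders k ∉ {i, j}, and the receiver's string y, there exist input strings x₁, …, xₙ, y ∈ {0,1}² satisfying the promise that x₁⁰ + ⋯ + xₙ⁰ + y⁰ is even, such that D's output differs from fₙ(x₁, …, xₙ, y). In other words, fₙ cannot be evaluated exactly if two or more senders are each limited to communicating only one classical bit, regardless of the resources available between the receiver and the remaining senders. -/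
/-- The function `fₙ` of the CCₙ task:
`fₙ(x₁,…,xₙ,y) = x₁¹ ⊕ ⋯ ⊕ xₙ¹ ⊕ y¹ ⊕ ℙ[(x₁⁰ + ⋯ + xₙ⁰ + y⁰)/2]`
(the XOR `x₁¹ ⊕ ⋯ ⊕ xₙ¹` is expressed as the parity of `∑ᵢ xᵢ¹`). -/
def fgen (n : ℕ) (x : Fin n → Bool × Bool) (y : Bool × Bool) : Bool :=
  xor (xor (bitP (∑ i, b2n (x i).2)) y.2)
      (bitP (((∑ i, b2n (x i).1) + b2n y.1) / 2))

/-- The promise condition: `x₁⁰ + ⋯ + xₙ⁰ + y⁰` is even. -/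
abbrev promiseN (n : ℕ) (x : Fin n → Bool × Bool) (y : Bool × Bool) : Prop :=
  Even ((∑ i, b2n (x i).1) + b2n y.1)

/-- A one-bit encoding that separates the second bits of its inputs with first bit `1` has a
collision between any given string and some string with first bit `1`. -/
lemma exists_encoding_collision (E : Bool × Bool → Bool)
    (hE : E (true, false) ≠ E (true, true)) (a : Bool × Bool) : ∃ s, E (true, s) = E a := by
  by_cases h : E (true, false) = E a
  · exact ⟨false, h⟩
  · refine ⟨true, ?_⟩
    revert hE h
    generalize E (true, false) = p, E (true, true) = q, E a = r
    revert p q r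
    decide

/-- The two-sender task cannot be solved when both senders communicate a single bit; the receiver's
first bit is `a.1 ⊕ b.1` by the promise, and her second bit is fixed to `0`. -/
lemma not_two_sender_protocol (E F : Bool × Bool → Bool) (D : Bool → Bool → Bool → Bool) :
    ¬ ∀ a b : Bool × Bool,
      D (E a) (F b) (xor a.1 b.1) = xor (xor a.2 b.2) (a.1 || b.1) := by
  intro h
  have hE : E (true, false) ≠ E (true, true) := fun e => by
    have h₀ := h (true, false) (false, false)
    have h₁ := h (true, true) (false, false)
    simp_all
  have hF : F (true, false) ≠ F (true, true) := fun e => by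
    have h₀ := h (false, false) (true, false)
    have h₁ := h (false, false) (true, true)
    simp_all
  obtain ⟨s, hs⟩ := exists_encoding_collision E hE (false, false)
  obtain ⟨t, ht⟩ := exists_encoding_collision F hF (false, false)
  have h₀₀ := h (false, false) (false, false)
  have h₀₁ := h (false, false) (true, t)
  have h₁₀ := h (true, s) (false, false)
  have h₁₁ := h (true, s) (true, t)
  rw [hs] at h₁₀ h₁₁
  rw [ht] at h₀₁ h₁₁
  cases s <;> cases t <;> simp_all

/-- The inputs in which senders `i` and `j` hold `a` and `b` and all others hold `00`. -/
def pairInput {n : ℕ} (i j : Fin n) (a b : Bool × Bool) (k : Fin n) : Bool × Bool :=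
  if k = i then a else if k = j then b else (false, false)

lemma sum_pairInput {n : ℕ} {i j : Fin n} (hij : i ≠ j) (a b : Bool × Bool)
    (f : Bool × Bool → ℕ) (hf : f (false, false) = 0) :
    ∑ k, f (pairInput i j a b k) = f a + f b := by
  rw [Fintype.sum_eq_add i j hij]
  · simp [pairInput, hij.symm]
  · rintro k ⟨hi, hj⟩
    simp [pairInput, hi, hj, hf]

/-- For `n ≥ 2`, if two distinct senders `i ≠ j` are each limited to
communicating a single classical bit, then no decoding — even one that receives
the complete input strings of all the other senders together with the
receiver's string — evaluates `fₙ` exactly on all promise inputs. -/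
theorem no_exact_fn_with_two_one_bit_senders (n : ℕ) (hn : 2 ≤ n)
    (i j : Fin n) (hij : i ≠ j) (Ei Ej : Bool × Bool → Bool)
    (D : Bool → Bool → ({ k : Fin n // k ≠ i ∧ k ≠ j } → Bool × Bool) →
          Bool × Bool → Bool) :
    ∃ (x : Fin n → Bool × Bool) (y : Bool × Bool), promiseN n x y ∧
      D (Ei (x i)) (Ej (x j)) (fun k => x k.1) y ≠ fgen n x y := by
  by_contra! H
  refine not_two_sender_protocol Ei Ej (fun p q c => D p q (fun _ => (false, false)) (c, false)) ?_
  intro a b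
  have h₁ := sum_pairInput hij a b (fun z => b2n z.1) rfl
  have h₂ := sum_pairInput hij a b (fun z => b2n z.2) rfl
  have h := H (pairInput i j a b) (xor a.1 b.1, false) (by
    rw [promiseN, h₁]
    clear h₁ h₂
    revert a b
    decide)
  have hrest : (fun k : { k : Fin n // k ≠ i ∧ k ≠ j } => pairInput i j a b k.1) =
      fun _ => (false, false) := by
    funext k
    simp [pairInput, k.2.1, k.2.2]
  have hi : pairInput i j a b i = a := by simp [pairInput]
  have hj : pairInput i j a b j = b := by simp [pairInput, hij.symm]
  rw [hrest, hi, hj, fgen, h₁, h₂] at h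
  refine h.trans ?_
  clear h h₁ h₂ hrest hi hj
  revert a b
  decide
end

section
/- Let K ≥ 1 and z : Fin K → {0,1}, and suppose S := #{i : z(i) = 1} is even. Then M_z.mulVec G_K = (-1)^{S/2} • G_K, i.e., the K-qubit GHZ state is an eigenvector of the tensor product of Pauli operators σ_{1+z(i)} with eigenvalue (−1)^{S/2}. -/
open Matrix

/-- Pauli matrices: `pauli 0 = σ₁` (Pauli-X) and `pauli 1 = σ₂` (Pauli-Y). -/
noncomputable def pauli : Fin 2 → Matrix (Fin 2) (Fin 2) ℂ
  | 0 => !![0, 1; 1, 0]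
  | 1 => !![0, -Complex.I; Complex.I, 0]

/-- `Mz K z` is the tensor (Kronecker) product over the `K` sites of `σ₁` at
sites with `z i = 0` and `σ₂` at sites with `z i = 1`:
`(Mz K z) f g = ∏ i, σ_{1 + z i} (f i) (g i)`. -/
noncomputable def Mz (K : ℕ) (z : Fin K → Fin 2) :
    Matrix (Fin K → Fin 2) (Fin K → Fin 2) ℂ :=
  Matrix.of fun f g => ∏ i, pauli (z i) (f i) (g i)

/-- The `K`-qubit GHZ state `(|0…0⟩ + |1…1⟩)/√2` as a vector on
`(Fin K → Fin 2) → ℂ`. -/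
noncomputable def GHZ (K : ℕ) : (Fin K → Fin 2) → ℂ :=
  fun f => if (∀ i, f i = 0) ∨ (∀ i, f i = 1) then ((1 / Real.sqrt 2 : ℝ) : ℂ) else 0

/-- Every Pauli-X or Pauli-Y matrix vanishes on the diagonal. -/
lemma pauli_apply_eq_zero {a x y : Fin 2} (h : y ≠ x + 1) : pauli a x y = 0 := by
  fin_cases a <;> fin_cases x <;> fin_cases y <;> simp_all [pauli]

lemma pauli_zero_one (a : Fin 2) : pauli a 0 1 = if a = 1 then -Complex.I else 1 := by
  fin_cases a <;> simp [pauli]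

lemma pauli_one_zero (a : Fin 2) : pauli a 1 0 = if a = 1 then Complex.I else 1 := by
  fin_cases a <;> simp [pauli]

/-- `Mz K z` flips every bit, up to a phase. -/
lemma Mz_mulVec_apply (K : ℕ) (z : Fin K → Fin 2) (v : (Fin K → Fin 2) → ℂ)
    (f : Fin K → Fin 2) :
    (Mz K z).mulVec v f = (∏ i, pauli (z i) (f i) (f i + 1)) * v (f + 1) := by
  rw [Matrix.mulVec, dotProduct, Finset.sum_eq_single (f + 1)]
  · simp [Mz]
  · intro g _ hg
    obtain ⟨i, hi⟩ := Function.ne_iff.mp hg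
    have h0 : Mz K z f g = 0 :=
      Finset.prod_eq_zero (Finset.mem_univ i) (pauli_apply_eq_zero hi)
    rw [h0, zero_mul]
  · simp

lemma GHZ_add_one (K : ℕ) (f : Fin K → Fin 2) : GHZ K (f + 1) = GHZ K f := by
  have h0 (x : Fin 2) : x + 1 = 0 ↔ x = 1 := by fin_cases x <;> simp
  have h1 (x : Fin 2) : x + 1 = 1 ↔ x = 0 := by fin_cases x <;> simp
  simp only [GHZ, Pi.add_apply, Pi.one_apply, h0, h1, or_comm]

/-- If the number `S` of sites where `z i = 1` (Pauli-Y sites) is even, then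
the GHZ state is an eigenvector of `Mz K z` with eigenvalue `(-1)^{S/2}`. -/
theorem ghz_eigenvector_even (K : ℕ) (hK : 1 ≤ K) (z : Fin K → Fin 2)
    (hS : Even (Finset.univ.filter (fun i => z i = 1)).card) :
    (Mz K z).mulVec (GHZ K) =
      ((-1 : ℂ) ^ ((Finset.univ.filter (fun i => z i = 1)).card / 2)) • GHZ K := by
  obtain ⟨m, hm⟩ := hS
  have hdiv : (m + m) / 2 = m := by omega
  ext f
  rw [Mz_mulVec_apply, GHZ_add_one, Pi.smul_apply, smul_eq_mul]
  by_cases h : (∀ i, f i = 0) ∨ (∀ i, f i = 1)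
  · congr 1
    rcases h with h | h
    · simp only [h, zero_add, pauli_zero_one]
      rw [Finset.prod_ite, Finset.prod_const, Finset.prod_const_one, hm, hdiv, mul_one,
        ← two_mul, pow_mul, neg_sq, Complex.I_sq]
    · have h11 : (1 : Fin 2) + 1 = 0 := rfl
      simp only [h, h11, pauli_one_zero]
      rw [Finset.prod_ite, Finset.prod_const, Finset.prod_const_one, hm, hdiv, mul_one,
        ← two_mul, pow_mul, Complex.I_sq]
  · simp [GHZ, h]
end

section
/- For every pair of one-bit encoding functions E₁, E₂ : {0,1}² → {0,1} and every decoding function D : {0,1} × {0,1} × {0,1}² → {0,1}, the number of triples (x₁, x₂, y) ∈ ({0,1}²)³ satisfying the promise x₁⁰ ⊕ x₂⁰ ⊕ y⁰ = 0 on which D(E₁(x₁), E₂(x₂), y) = f₂(x₁, x₂, y) is at most 24 out of the 32 promise-satisfying triples. Equivalently, the success probability of any deterministic one-bit classical strategy for the CC₂ task, under the uniform distribution on promise inputs, is at most 3/4. -/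
/-- The number of promise inputs `(x₁, x₂)`, for fixed `y`, on which the messages are `(a, b)` and
`f₂` takes the value `d`. -/
def messageCount (E1 E2 : Bool × Bool → Bool) (y : Bool × Bool) (a b d : Bool) : ℕ :=
  (Finset.univ.filter fun p : (Bool × Bool) × (Bool × Bool) =>
    E1 p.1 = a ∧ E2 p.2 = b ∧ promise2 p.1 p.2 y ∧ f2 p.1 p.2 y = d).card

/-- The sum of a function over the two bits. -/
def boolSum (g : Bool → ℕ) : ℕ := g false + g true

/-- `messageCount` as an explicit sum: the promise determines `x₂⁰`, and the carry
`(x₁⁰ + x₂⁰ + y⁰) / 2` is then `x₁⁰ ∨ y⁰`. -/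
def messageSum (E1 E2 : Bool × Bool → Bool) (y : Bool × Bool) (a b d : Bool) : ℕ :=
  boolSum fun p => boolSum fun q => cond (xor (E1 (p, q)) a) 0 <|
    boolSum fun r => cond (xor (E2 (xor p y.1, r)) b) 0 <|
      cond (xor (xor (xor (xor q r) y.2) (p || y.1)) d) 0 1

theorem messageCount_eq_messageSum (E1 E2 : Bool × Bool → Bool) (y : Bool × Bool)
    (a b d : Bool) : messageCount E1 E2 y a b d = messageSum E1 E2 y a b d := by
  obtain ⟨s, t⟩ := y
  have boolSum_eq (g : Bool → ℕ) : boolSum g = ∑ x, g x := by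
    rw [Fintype.sum_bool, boolSum, add_comm]
  simp only [messageCount, messageSum, Finset.card_filter, Fintype.sum_prod_type, boolSum_eq]
  refine Fintype.sum_congr _ _ fun p => Fintype.sum_congr _ _ fun q => ?_
  cases h : xor (E1 (p, q)) a
  · rw [Fintype.sum_eq_single (xor p s)]
    · refine Fintype.sum_congr _ _ fun r => ?_
      rw [bne_eq_false_iff_eq] at h
      simp only [h, true_and]
      generalize E2 (xor p s, r) = e
      clear h
      revert s t b d p q r e
      decide
    · intro p' hp'
      refine Finset.sum_eq_zero fun r _ => if_neg ?_
      rintro ⟨-, -, hp, -⟩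
      revert p p' s
      simp
  · refine Finset.sum_eq_zero fun p' _ => Finset.sum_eq_zero fun r _ => if_neg ?_
    rintro ⟨hE, -⟩
    simp [hE] at h

/-- The number of successes of an optimal decoder, over all inputs with a given `y`. -/
def optimalSuccess (E1 E2 : Bool × Bool → Bool) (y : Bool × Bool) : ℕ :=
  boolSum fun a => boolSum fun b =>
    max (messageSum E1 E2 y a b false) (messageSum E1 E2 y a b true)

/-- The encoding with a given truth table. -/
def ofTable (u v w z : Bool) (x : Bool × Bool) : Bool :=
  cond x.1 (cond x.2 z w) (cond x.2 v u)

theorem eq_ofTable (E : Bool × Bool → Bool) :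
    E = ofTable (E (false, false)) (E (false, true)) (E (true, false)) (E (true, true)) := by
  funext ⟨p, q⟩
  cases p <;> cases q <;> rfl

/-- An optimal decoder answers, for each pair of messages and each `y`, with the majority value. -/
theorem sum_max_messageCount_le (E1 E2 : Bool × Bool → Bool) :
    ∑ k : (Bool × Bool) × Bool × Bool,
      max (messageCount E1 E2 k.1 k.2.1 k.2.2 false)
        (messageCount E1 E2 k.1 k.2.1 k.2.2 true) ≤ 24 := by
  have h : ∀ u v w z u' v' w' z' : Bool,
      (boolSum fun s => boolSum fun t =>
        optimalSuccess (ofTable u v w z) (ofTable u' v' w' z') (s, t)) ≤ 24 := by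
    decide +kernel
  have h' := h (E1 (false, false)) (E1 (false, true)) (E1 (true, false)) (E1 (true, true))
    (E2 (false, false)) (E2 (false, true)) (E2 (true, false)) (E2 (true, true))
  rw [← eq_ofTable E1, ← eq_ofTable E2] at h'
  simp only [messageCount_eq_messageSum, Fintype.sum_prod_type, Fintype.sum_bool]
  simp only [boolSum, optimalSuccess] at h'
  omega

theorem card_success_le_sum_max (E1 E2 : Bool × Bool → Bool)
    (D : Bool → Bool → Bool × Bool → Bool) :
    (Finset.univ.filter
        (fun t : (Bool × Bool) × (Bool × Bool) × (Bool × Bool) =>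
          promise2 t.1 t.2.1 t.2.2 ∧
            D (E1 t.1) (E2 t.2.1) t.2.2 = f2 t.1 t.2.1 t.2.2)).card ≤
    ∑ k : (Bool × Bool) × Bool × Bool,
      max (messageCount E1 E2 k.1 k.2.1 k.2.2 false)
        (messageCount E1 E2 k.1 k.2.1 k.2.2 true) := by
  rw [Finset.card_eq_sum_card_fiberwise (t := Finset.univ)
    (f := fun t => (t.2.2, E1 t.1, E2 t.2.1)) (fun _ _ => Finset.mem_coe.2 (Finset.mem_univ _))]
  refine Finset.sum_le_sum fun ⟨y, a, b⟩ _ => ?_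
  trans messageCount E1 E2 y a b (D a b y)
  · refine Finset.card_le_card_of_injOn (fun t => (t.1, t.2.1)) ?_ ?_
    · rintro ⟨x₁, x₂, z⟩ h
      simp only [Finset.coe_filter, Finset.mem_filter, Finset.mem_univ, true_and,
        Set.mem_ofPred_eq, Prod.mk.injEq] at h ⊢
      obtain ⟨⟨hp, hD⟩, rfl, rfl, rfl⟩ := h
      exact ⟨rfl, rfl, hp, hD.symm⟩
    · rintro ⟨x₁, x₂, z⟩ h ⟨x₁', x₂', z'⟩ h' heq
      simp_all
  · cases D a b y
    · exact le_max_left _ _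
    · exact le_max_right _ _

/-- Any deterministic one-bit classical strategy for the CC₂ task succeeds on
at most 24 of the 32 promise-satisfying triples, i.e. its success probability
under the uniform distribution on promise inputs is at most 3/4. -/
theorem deterministic_success_at_most_24_of_32
    (E1 E2 : Bool × Bool → Bool) (D : Bool → Bool → Bool × Bool → Bool) :
    (Finset.univ.filter
        (fun t : (Bool × Bool) × (Bool × Bool) × (Bool × Bool) =>
          promise2 t.1 t.2.1 t.2.2 ∧
            D (E1 t.1) (E2 t.2.1) t.2.2 = f2 t.1 t.2.1 t.2.2)).card ≤ 24 ∧
    (Finset.univ.filter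
        (fun t : (Bool × Bool) × (Bool × Bool) × (Bool × Bool) =>
          promise2 t.1 t.2.1 t.2.2)).card = 32 := by
  exact ⟨(card_success_le_sum_max E1 E2 D).trans (sum_max_messageCount_le E1 E2), by decide⟩
end

section
/- For every n ≥ 2, every tuple of one-bit encoding functions E₁, …, Eₙ : {0,1}² → {0,1} and every decoding function D : {0,1}ⁿ × {0,1}² → {0,1} (taking the n communicated bits and the receiver's string y), the fraction of tuples (x₁, …, xₙ, y) ∈ ({0,1}²)^{n+1} satisfying the promise that x₁⁰ + ⋯ + xₙ⁰ + y⁰ is even, on which D(E₁(x₁), …, Eₙ(xₙ), y) = fₙ(x₁, …, xₙ, y), is at most 3/4. That is, with one bit of classical communication from each sender, the success probability of any deterministic strategy for the CCₙ task under the uniform distribution on promise inputs is at most 3/4. -/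
/-- The sign `(-1)^b` of a bit. -/
def bitSign (b : Bool) : ℤ := cond b (-1) 1

/-- The fourth root of unity `(-1)^(x¹) i^(x⁰)` attached to a two-bit string. -/
def phase (x : Bool × Bool) : GaussianInt := (-1) ^ b2n x.2 * (⟨0, 1⟩ : GaussianInt) ^ b2n x.1

/-- The `ℓ¹` norm of a Gaussian integer. -/
def gaussL1 (z : GaussianInt) : ℤ := |z.re| + |z.im|

theorem bitSign_xor (a b : Bool) : bitSign (xor a b) = bitSign a * bitSign b := by
  cases a <;> cases b <;> rfl

theorem bitSign_eq_pow (b : Bool) : bitSign b = (-1) ^ b2n b := by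
  cases b <;> rfl

theorem bitSign_bitP (r : ℕ) : bitSign (bitP r) = (-1) ^ r := by
  rcases Nat.even_or_odd r with h | h
  · rw [h.neg_one_pow]
    simp [bitP, bitSign, Nat.even_iff.mp h]
  · rw [h.neg_one_pow]
    simp [bitP, bitSign, Nat.odd_iff.mp h]

theorem re_neg_one_pow_mul (a : ℕ) (z : GaussianInt) :
    ((-1) ^ a * z).re = (-1) ^ a * z.re := by
  rcases Nat.even_or_odd a with h | h <;> simp [h.neg_one_pow]

theorem re_I_pow (b : ℕ) :
    ((⟨0, 1⟩ : GaussianInt) ^ b).re = if Even b then (-1) ^ (b / 2) else 0 := by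
  have hsq : (⟨0, 1⟩ : GaussianInt) ^ 2 = -1 := by
    rw [pow_two]; rfl
  rcases Nat.even_or_odd' b with ⟨r, rfl | rfl⟩
  · have := re_neg_one_pow_mul r 1
    rw [pow_mul, hsq]
    simpa using this
  · rw [pow_succ, pow_mul, hsq, re_neg_one_pow_mul]
    simp

/-- The real part of the product of all phases is the signed value of `fₙ` on promise inputs and
vanishes elsewhere. -/
theorem re_phase_mul_prod (n : ℕ) (x : Fin n → Bool × Bool) (y : Bool × Bool) :
    (phase y * ∏ i, phase (x i)).re =
      if promiseN n x y then bitSign (fgen n x y) else 0 := by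
  have h : phase y * ∏ i, phase (x i) =
      (-1) ^ (∑ i, b2n (x i).2 + b2n y.2) *
        (⟨0, 1⟩ : GaussianInt) ^ (∑ i, b2n (x i).1 + b2n y.1) := by
    simp only [phase, Finset.prod_mul_distrib, Finset.prod_pow_eq_pow_sum, pow_add]
    ring
  rw [h, re_neg_one_pow_mul, re_I_pow]
  unfold promiseN
  split_ifs
  · rw [fgen, bitSign_xor, bitSign_xor, bitSign_bitP, bitSign_bitP, bitSign_eq_pow y.2, pow_add]
  · rw [mul_zero]

/-- The sum of the phases of the strings which the encoder `e` sends to the bit `b`. -/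
def fiberPhase (e : Bool × Bool → Bool) (b : Bool) : GaussianInt :=
  ∑ a, if e a = b then phase a else 0

theorem abs_fiberPhase_le_one (e : Bool × Bool → Bool) (b : Bool) :
    |(fiberPhase e b).re| ≤ 1 ∧ |(fiberPhase e b).im| ≤ 1 := by
  simp only [fiberPhase, Fintype.sum_prod_type, Fintype.sum_bool]
  split_ifs <;> decide

theorem gaussL1_mul_le {t : GaussianInt} (ht : |t.re| ≤ 1 ∧ |t.im| ≤ 1) (z : GaussianInt) :
    gaussL1 (t * z) ≤ 2 * gaussL1 z := by
  obtain ⟨h₁, h₂⟩ := ht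
  rw [abs_le] at h₁ h₂
  obtain ⟨a, b⟩ := t
  obtain ⟨c, d⟩ := z
  simp only [gaussL1, Zsqrtd.re_mul, Zsqrtd.im_mul] at *
  obtain ⟨h₁, h₁'⟩ := h₁
  obtain ⟨h₂, h₂'⟩ := h₂
  interval_cases a <;> interval_cases b <;> simp only [abs_eq_max_neg] <;> omega

theorem gaussL1_mul_le_two {s t : GaussianInt} (hs : |s.re| ≤ 1 ∧ |s.im| ≤ 1)
    (ht : |t.re| ≤ 1 ∧ |t.im| ≤ 1) : gaussL1 (s * t) ≤ 2 := by
  obtain ⟨a, b⟩ := s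
  obtain ⟨c, d⟩ := t
  simp only [gaussL1, Zsqrtd.re_mul, Zsqrtd.im_mul, abs_le] at *
  obtain ⟨⟨h₁, h₁'⟩, h₂, h₂'⟩ := hs
  obtain ⟨⟨h₃, h₃'⟩, h₄, h₄'⟩ := ht
  interval_cases a <;> interval_cases b <;> interval_cases c <;> interval_cases d <;> decide

theorem gaussL1_prod_mul_le (k : ℕ) (t : Fin k → GaussianInt)
    (ht : ∀ i, |(t i).re| ≤ 1 ∧ |(t i).im| ≤ 1) (z : GaussianInt) :
    gaussL1 ((∏ i, t i) * z) ≤ 2 ^ k * gaussL1 z := by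
  induction k with
  | zero => simp
  | succ k ih =>
    rw [Fin.prod_univ_succ, mul_assoc, pow_succ']
    have h := ih (fun i => t i.succ) fun i => ht i.succ
    have h' := gaussL1_mul_le (ht 0) ((∏ i : Fin k, t i.succ) * z)
    linarith

theorem two_mul_gaussL1_prod_le {n : ℕ} (hn : 2 ≤ n) (t : Fin n → GaussianInt)
    (ht : ∀ i, |(t i).re| ≤ 1 ∧ |(t i).im| ≤ 1) :
    2 * gaussL1 (∏ i, t i) ≤ 2 ^ n := by
  obtain ⟨k, rfl⟩ := Nat.exists_eq_add_of_le' hn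
  have h := gaussL1_prod_mul_le k (fun i => t i.succ.succ) (fun i => ht _) (t 0 * t (Fin.succ 0))
  have h' := gaussL1_mul_le_two (ht 0) (ht (Fin.succ 0))
  rw [Fin.prod_univ_succ, Fin.prod_univ_succ, ← mul_assoc, mul_comm (t 0 * _)]
  have h2 : (0 : ℤ) < 2 ^ k := by positivity
  rw [pow_add]
  nlinarith

theorem sum_phase_fiber (n : ℕ) (E : Fin n → Bool × Bool → Bool) (m : Fin n → Bool) :
    ∑ x : Fin n → Bool × Bool with (fun i => E i (x i)) = m, ∏ i, phase (x i) = ∏ i, fiberPhase (E i) (m i) := by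
  simp only [fiberPhase, Fintype.prod_sum, Finset.sum_filter]
  refine Finset.sum_congr rfl fun x _ => ?_
  rw [Finset.prod_ite_zero]
  simp [funext_iff]

theorem sum_bitSign_mul_re_le (s : Bool × Bool → Bool) (z : GaussianInt) :
    ∑ y, bitSign (s y) * (phase y * z).re ≤ 2 * gaussL1 z := by
  have h : ∀ (b : Bool) (r : ℤ), bitSign b * r ≤ |r| := by
    intro b r
    cases b <;> simp [bitSign, le_abs_self, neg_le_abs]
  refine (Finset.sum_le_sum fun y _ => h (s y) _).trans ?_
  simp [Fintype.sum_prod_type, phase, b2n, gaussL1]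
  linarith

/-- The bias of a strategy (successes minus failures) is at most `4 ^ n`. -/
theorem bias_le {n : ℕ} (hn : 2 ≤ n) (E : Fin n → Bool × Bool → Bool)
    (D : (Fin n → Bool) → Bool × Bool → Bool) :
    ∑ t : (Fin n → Bool × Bool) × (Bool × Bool),
      bitSign (D (fun i => E i (t.1 i)) t.2) * (phase t.2 * ∏ i, phase (t.1 i)).re ≤ 4 ^ n := by
  have hre : ∀ (s : Finset (Fin n → Bool × Bool)) (f : (Fin n → Bool × Bool) → GaussianInt),
      (∑ x ∈ s, f x).re = ∑ x ∈ s, (f x).re := fun s f =>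
    map_sum (AddMonoidHom.mk' (fun z : GaussianInt => z.re) fun _ _ => rfl) f s
  have hfiber : ∀ y, ∑ x : Fin n → Bool × Bool,
      bitSign (D (fun i => E i (x i)) y) * (phase y * ∏ i, phase (x i)).re =
      ∑ m, bitSign (D m y) * (phase y * ∏ i, fiberPhase (E i) (m i)).re := by
    intro y
    rw [← Finset.sum_fiberwise Finset.univ fun (x : Fin n → Bool × Bool) i => E i (x i)]
    refine Finset.sum_congr rfl fun m _ => ?_
    rw [← sum_phase_fiber, Finset.mul_sum, hre, Finset.mul_sum]
    refine Finset.sum_congr rfl fun x hx => ?_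
    rw [(Finset.mem_filter.mp hx).2]
  rw [Fintype.sum_prod_type_right]
  simp only [hfiber]
  rw [Finset.sum_comm]
  calc _ ≤ ∑ _m : Fin n → Bool, (2 : ℤ) ^ n := Finset.sum_le_sum fun m _ =>
        (sum_bitSign_mul_re_le (D m) _).trans
          (two_mul_gaussL1_prod_le hn _ fun i => abs_fiberPhase_le_one _ _)
    _ = 4 ^ n := by
      simp [← mul_pow]

theorem card_promiseN (n : ℕ) :
    (Finset.univ.filter (fun t : (Fin n → Bool × Bool) × (Bool × Bool) =>
      promiseN n t.1 t.2)).card = 2 * 4 ^ n := by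
  rw [Finset.card_filter, Fintype.sum_prod_type]
  have h : ∀ x : Fin n → Bool × Bool,
      ∑ y : Bool × Bool, (if promiseN n x y then 1 else 0) = 2 := by
    intro x
    simp only [promiseN, Fintype.sum_prod_type, Fintype.sum_bool, b2n, cond_true, cond_false,
      add_zero, Nat.even_add_one]
    split_ifs <;> simp_all
  simp [h, mul_comm]

/-- The bias is the number of successes minus the number of failures. -/
theorem bias_eq (n : ℕ) (E : Fin n → Bool × Bool → Bool)
    (D : (Fin n → Bool) → Bool × Bool → Bool) :
    ∑ t : (Fin n → Bool × Bool) × (Bool × Bool),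
      bitSign (D (fun i => E i (t.1 i)) t.2) * (phase t.2 * ∏ i, phase (t.1 i)).re =
    2 * ((Finset.univ.filter
        (fun t : (Fin n → Bool × Bool) × (Bool × Bool) =>
          promiseN n t.1 t.2 ∧
            D (fun i => E i (t.1 i)) t.2 = fgen n t.1 t.2)).card : ℤ) -
      ((Finset.univ.filter
        (fun t : (Fin n → Bool × Bool) × (Bool × Bool) =>
          promiseN n t.1 t.2)).card : ℤ) := by
  simp only [Finset.card_filter, re_phase_mul_prod]
  push_cast
  rw [Finset.mul_sum, ← Finset.sum_sub_distrib]
  refine Finset.sum_congr rfl fun t _ => ?_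
  by_cases hp : promiseN n t.1 t.2
  · simp only [hp, true_and, if_true]
    generalize D (fun i => E i (t.1 i)) t.2 = a
    generalize fgen n t.1 t.2 = b
    cases a <;> cases b <;> rfl
  · simp [hp]

/-- For `n ≥ 2`, with one bit of classical communication from each sender, any
deterministic strategy for the CCₙ task succeeds, under the uniform
distribution on promise inputs, on at most a 3/4 fraction of the
promise-satisfying input tuples. -/
theorem deterministic_success_fraction_at_most_three_quarters
    (n : ℕ) (hn : 2 ≤ n) (E : Fin n → Bool × Bool → Bool)
    (D : (Fin n → Bool) → Bool × Bool → Bool) :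
    ((Finset.univ.filter
        (fun t : (Fin n → Bool × Bool) × (Bool × Bool) =>
          promiseN n t.1 t.2 ∧
            D (fun i => E i (t.1 i)) t.2 = fgen n t.1 t.2)).card : ℚ) /
      ((Finset.univ.filter
        (fun t : (Fin n → Bool × Bool) × (Bool × Bool) =>
          promiseN n t.1 t.2)).card : ℚ) ≤ 3 / 4 := by
  have h := (bias_eq n E D).symm.trans_le (bias_le hn E D)
  rw [card_promiseN] at h ⊢
  rw [div_le_iff₀ (by positivity)]
  have h' := (Int.cast_le (R := ℚ)).mpr h
  push_cast at h' ⊢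
  linarith
end

section
/- For every probability distribution μ over deterministic strategies — tuples (E₁, E₂, D) with one-bit encodings E₁, E₂ : {0,1}² → {0,1} and decoder D : {0,1} × {0,1} × {0,1}² → {0,1} — the average over the uniform distribution on promise inputs (x₁, x₂, y) with x₁⁰ ⊕ x₂⁰ ⊕ y⁰ = 0 of the μ-probability that D(E₁(x₁), E₂(x₂), y) = f₂(x₁, x₂, y) is at most 3/4. That is, shared randomness does not improve the optimal classical success probability 3/4 for the CC₂ task with one bit of communication from each sender. -/
/-- A deterministic strategy: one-bit encodings `E₁, E₂` for the two senders
and a decoding `D` for the receiver. -/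
abbrev Strategy :=
  ((Bool × Bool) → Bool) × ((Bool × Bool) → Bool) × (Bool → Bool → Bool × Bool → Bool)

theorem bitSign_true : bitSign true = -1 := rfl

theorem bitSign_false : bitSign false = 1 := rfl

/-- Half the signed difference of the two messages that `E` sends when the first bit is `c`. -/
def encodingBias (E : Bool × Bool → Bool) (c : Bool) : ℤ :=
  (E (c, true)).toInt - (E (c, false)).toInt

/-- The mixed second difference of a function of two bits. -/
def mixedDiff (F : Bool → Bool → ℤ) : ℤ :=
  F false false - F false true - F true false + F true true

theorem abs_encodingBias_le (E : Bool × Bool → Bool) (c : Bool) : |encodingBias E c| ≤ 1 := by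
  unfold encodingBias
  cases E (c, true) <;> cases E (c, false) <;> decide

theorem sum_bitSign_mul_comp (E : Bool × Bool → Bool) (c : Bool) (G : Bool → ℤ) :
    ∑ v, bitSign v * G (E (c, v)) = encodingBias E c * (G false - G true) := by
  simp only [Fintype.sum_bool, encodingBias, bitSign]
  cases E (c, true) <;> cases E (c, false) <;> simp <;> ring

theorem sum_sum_bitSign_mul_comp (E₁ E₂ : Bool × Bool → Bool) (c₁ c₂ : Bool)
    (F : Bool → Bool → ℤ) :
    ∑ v₁, ∑ v₂, bitSign v₁ * bitSign v₂ * F (E₁ (c₁, v₁)) (E₂ (c₂, v₂)) =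
      encodingBias E₁ c₁ * encodingBias E₂ c₂ * mixedDiff F := by
  simp only [mul_assoc, ← Finset.mul_sum, sum_bitSign_mul_comp E₂ c₂]
  rw [sum_bitSign_mul_comp E₁ c₁ fun a => encodingBias E₂ c₂ * (F a false - F a true)]
  unfold mixedDiff
  ring

theorem abs_mixedDiff_bitSign_le (d : Bool → Bool → Bool) :
    |mixedDiff fun a b => bitSign (d a b)| ≤ 4 := by
  have habs (b : Bool) : -1 ≤ bitSign b ∧ bitSign b ≤ 1 := by cases b <;> decide
  have h₁ := habs (d false false)
  have h₂ := habs (d false true)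
  have h₃ := habs (d true false)
  have h₄ := habs (d true true)
  rw [abs_le]
  unfold mixedDiff
  constructor <;> linarith

/-- A CHSH-type inequality for integers of absolute value at most one. -/
theorem abs_sub_add_abs_add_le_two {a b c d : ℤ} (ha : |a| ≤ 1) (hb : |b| ≤ 1) (hc : |c| ≤ 1)
    (hd : |d| ≤ 1) : |a * c - b * d| + |a * d + b * c| ≤ 2 := by
  rw [abs_le] at ha hb hc hd
  obtain ⟨_, _⟩ := ha
  obtain ⟨_, _⟩ := hb
  obtain ⟨_, _⟩ := hc
  obtain ⟨_, _⟩ := hd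
  interval_cases a <;> interval_cases b <;> interval_cases c <;> interval_cases d <;> decide

/-- The inputs satisfying the promise. -/
abbrev promiseInputs : Finset ((Bool × Bool) × (Bool × Bool) × (Bool × Bool)) :=
  Finset.univ.filter fun t => promise2 t.1 t.2.1 t.2.2

theorem card_promiseInputs : promiseInputs.card = 32 := by decide

/-- The strategy `s` computes `f2` correctly on the input `t`. -/
abbrev Wins (s : Strategy) (t : (Bool × Bool) × (Bool × Bool) × (Bool × Bool)) : Prop :=
  s.2.2 (s.1 t.1) (s.2.1 t.2.1) t.2.2 = f2 t.1 t.2.1 t.2.2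

theorem sum_promiseInputs_sign (s : Strategy) :
    ∑ t ∈ promiseInputs,
        bitSign (s.2.2 (s.1 t.1) (s.2.1 t.2.1) t.2.2) * bitSign (f2 t.1 t.2.1 t.2.2) =
      ∑ y : Bool × Bool, bitSign y.2 * mixedDiff (fun a b => bitSign (s.2.2 a b y)) *
        ∑ c, bitSign (c || y.1) * (encodingBias s.1 c * encodingBias s.2.1 (xor c y.1)) := by
  have factored (y : Bool × Bool) :
      bitSign y.2 * mixedDiff (fun a b => bitSign (s.2.2 a b y)) *
        ∑ c, bitSign (c || y.1) * (encodingBias s.1 c * encodingBias s.2.1 (xor c y.1)) =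
      ∑ c, bitSign y.2 * bitSign (c || y.1) * ∑ v₁, ∑ v₂, bitSign v₁ * bitSign v₂ *
        bitSign (s.2.2 (s.1 (c, v₁)) (s.2.1 (xor c y.1, v₂)) y) := by
    rw [Finset.mul_sum]
    refine Finset.sum_congr rfl fun c _ => ?_
    rw [sum_sum_bitSign_mul_comp s.1 s.2.1 c (xor c y.1) fun a b => bitSign (s.2.2 a b y)]
    ring
  rw [Finset.sum_congr rfl fun y _ => factored y]
  simp only [Finset.sum_filter, Fintype.sum_prod_type, Fintype.sum_bool]
  simp [promise2, f2, bitP, b2n, bitSign_true, bitSign_false]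
  ring

theorem sum_promiseInputs_sign_le (s : Strategy) :
    ∑ t ∈ promiseInputs,
        bitSign (s.2.2 (s.1 t.1) (s.2.1 t.2.1) t.2.2) * bitSign (f2 t.1 t.2.1 t.2.2) ≤ 16 := by
  rw [sum_promiseInputs_sign]
  have chsh := abs_sub_add_abs_add_le_two (abs_encodingBias_le s.1 false)
    (abs_encodingBias_le s.1 true) (abs_encodingBias_le s.2.1 false)
    (abs_encodingBias_le s.2.1 true)
  have bound (y : Bool × Bool) (z : ℤ) :
      bitSign y.2 * mixedDiff (fun a b => bitSign (s.2.2 a b y)) * z ≤ 4 * |z| := by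
    have hsign : |bitSign y.2| = 1 := by cases y.2 <;> rfl
    calc _ ≤ |bitSign y.2 * mixedDiff (fun a b => bitSign (s.2.2 a b y)) * z| := le_abs_self _
      _ ≤ 4 * |z| := by
        rw [abs_mul, abs_mul, hsign, one_mul]
        gcongr
        exact abs_mixedDiff_bitSign_le fun a b => s.2.2 a b y
  refine (Finset.sum_le_sum fun y _ => bound y _).trans ?_
  simp only [Fintype.sum_prod_type, Fintype.sum_bool, bitSign, Bool.or_true, Bool.or_false,
    Bool.xor_true, Bool.xor_false, Bool.not_true, Bool.not_false, cond_true, cond_false]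
  grind

theorem card_wins_le (s : Strategy) : (promiseInputs.filter (Wins s)).card ≤ 24 := by
  have indicator (a b : Bool) : (if a = b then 2 else 0 : ℤ) = 1 + bitSign a * bitSign b := by
    cases a <;> cases b <;> rfl
  have hcount : 2 * ((promiseInputs.filter (Wins s)).card : ℤ) = 32 + ∑ t ∈ promiseInputs,
      bitSign (s.2.2 (s.1 t.1) (s.2.1 t.2.1) t.2.2) * bitSign (f2 t.1 t.2.1 t.2.2) := by
    calc 2 * ((promiseInputs.filter (Wins s)).card : ℤ)
        = ∑ t ∈ promiseInputs, if Wins s t then 2 else 0 := by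
          rw [← Finset.sum_filter, Finset.sum_const, nsmul_eq_mul, mul_comm]
      _ = _ := by
          simp only [indicator, Finset.sum_add_distrib, Finset.sum_const, card_promiseInputs]
          norm_num
  have := sum_promiseInputs_sign_le s
  lia

/-- For every probability distribution `μ` over deterministic strategies, the
average over the uniform distribution on promise inputs of the `μ`-probability
of success is at most 3/4: shared randomness does not improve the optimal
classical success probability for the CC₂ task with one bit of communication
from each sender. -/
theorem shared_randomness_success_at_most_three_quarters
    (μ : Strategy → ℝ) (hμ0 : ∀ s, 0 ≤ μ s) (hμ1 : ∑ s, μ s = 1) :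
    (∑ t ∈ Finset.univ.filter
        (fun t : (Bool × Bool) × (Bool × Bool) × (Bool × Bool) =>
          promise2 t.1 t.2.1 t.2.2),
      ∑ s ∈ Finset.univ.filter
        (fun s : Strategy => s.2.2 (s.1 t.1) (s.2.1 t.2.1) t.2.2 = f2 t.1 t.2.1 t.2.2),
        μ s) /
      ((Finset.univ.filter
        (fun t : (Bool × Bool) × (Bool × Bool) × (Bool × Bool) =>
          promise2 t.1 t.2.1 t.2.2)).card : ℝ) ≤ 3 / 4 := by
  change (∑ t ∈ promiseInputs, ∑ s ∈ Finset.univ.filter (fun s => Wins s t), μ s) /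
    (promiseInputs.card : ℝ) ≤ 3 / 4
  rw [card_promiseInputs, div_le_iff₀ (by norm_num)]
  calc ∑ t ∈ promiseInputs, ∑ s ∈ Finset.univ.filter (fun s => Wins s t), μ s
      = ∑ s, ((promiseInputs.filter (Wins s)).card : ℝ) * μ s := by
        simp only [Finset.sum_filter (fun s => Wins s _)]
        rw [Finset.sum_comm]
        refine Finset.sum_congr rfl fun s _ => ?_
        rw [← Finset.sum_filter, Finset.sum_const, nsmul_eq_mul]
    _ ≤ ∑ s, 24 * μ s := Finset.sum_le_sum fun s _ =>
        mul_le_mul_of_nonneg_right (mod_cast card_wins_le s) (hμ0 s)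
    _ = 3 / 4 * (32 : ℕ) := by
        rw [← Finset.mul_sum, hμ1]
        norm_num
end

section
/- Let E₁ = g^{α₁,β₁,γ₁,δ₁}, E₂ = g^{α₂,β₂,γ₂,δ₂} and D₁ = g^{α₃¹,β₃¹,γ₃¹,δ₃¹} be Boolean functions of two bits in algebraic normal form. If D₁(E₁(x₁⁰, x₁¹), E₂(x₂⁰, x₂¹)) = x₁¹ ⊕ x₂¹ ⊕ 1 holds for all bits x₁⁰, x₁¹, x₂⁰, x₂¹ with x₁⁰ ≠ x₂⁰, then necessarily β₁ = β₂ = β₃¹ = α₃¹ = 1, γ₁ = γ₂ = γ₃¹ = 0, and α₁ = α₂. -/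
/-- The algebraic normal form of a two-bit Boolean function:
`g^{α,β,γ,δ}(u,v) = (α ∧ u) ⊕ (β ∧ v) ⊕ (γ ∧ u ∧ v) ⊕ δ`. -/
def ganf (α β γ δ u v : Bool) : Bool :=
  xor (xor (xor (α && u) (β && v)) (γ && (u && v))) δ

/-- If `D₁(E₁(x₁⁰,x₁¹), E₂(x₂⁰,x₂¹)) = x₁¹ ⊕ x₂¹ ⊕ 1` holds for all bits with
`x₁⁰ ≠ x₂⁰`, then necessarily `β₁ = β₂ = β₃¹ = α₃¹ = 1`, `γ₁ = γ₂ = γ₃¹ = 0`,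
and `α₁ = α₂`. -/
theorem anf_restrictions_for_y0_eq_one
    (α₁ β₁ γ₁ δ₁ α₂ β₂ γ₂ δ₂ α₃ β₃ γ₃ δ₃ : Bool)
    (h : ∀ x10 x11 x20 x21 : Bool, x10 ≠ x20 →
      ganf α₃ β₃ γ₃ δ₃ (ganf α₁ β₁ γ₁ δ₁ x10 x11) (ganf α₂ β₂ γ₂ δ₂ x20 x21)
        = xor (xor x11 x21) true) :
    β₁ = true ∧ β₂ = true ∧ β₃ = true ∧ α₃ = true ∧
      γ₁ = false ∧ γ₂ = false ∧ γ₃ = false ∧ α₁ = α₂ := by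
  have h01 := fun x y => h false x true y (by decide)
  have h10 := fun x y => h true x false y (by decide)
  clear h
  revert h01 h10
  simp only [ganf, Bool.forall_bool]
  cases β₁ <;> cases β₂ <;> cases γ₁ <;> cases γ₂ <;> cases α₃ <;> cases β₃ <;> cases γ₃ <;>
    revert α₁ α₂ δ₁ δ₂ δ₃ <;> decide
end

section
/- Let E₁ = g^{α₁,β₁,γ₁,δ₁}, E₂ = g^{α₂,β₂,γ₂,δ₂} and D₀ = g^{α₃⁰,β₃⁰,γ₃⁰,δ₃⁰} be Boolean functions of two bits in algebraic normal form. If D₀(E₁(x₁⁰, x₁¹), E₂(x₂⁰, x₂¹)) = x₁¹ ⊕ x₂¹ ⊕ (x₁⁰ ∨ x₂⁰) holds for all bits x₁⁰, x₁¹, x₂⁰, x₂¹ with x₁⁰ = x₂⁰, then necessarily α₃⁰ = β₃⁰ = 1, γ₃⁰ = 0, δ₁ = δ₂ ⊕ δ₃⁰, and α₁ ≠ α₂. -/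
/-- If `D(β₁ a ⊕ δ₁, β₂ b ⊕ δ₂) = a ⊕ b` for all bits `a`, `b`, then `D` is affine in both
arguments, with constant term `δ₁ ⊕ δ₂`. -/
theorem ganf_coeffs_of_eq_xor (β₁ δ₁ β₂ δ₂ α β γ δ : Bool)
    (h : ∀ a b : Bool,
      ganf α β γ δ (xor (β₁ && a) δ₁) (xor (β₂ && b) δ₂) = xor a b) :
    α = true ∧ β = true ∧ γ = false ∧ δ₁ = xor δ₂ δ := by
  have h00 := h false false
  have h01 := h false true
  have h10 := h true false
  have h11 := h true true
  clear h
  cases β₁ <;> cases δ₁ <;> cases β₂ <;> cases δ₂ <;> cases α <;> cases β <;> cases γ <;>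
    cases δ <;> simp_all [ganf]

/-- If `D₀(E₁(x₁⁰,x₁¹), E₂(x₂⁰,x₂¹)) = x₁¹ ⊕ x₂¹ ⊕ (x₁⁰ ∨ x₂⁰)` holds for all
bits with `x₁⁰ = x₂⁰`, then necessarily `α₃⁰ = β₃⁰ = 1`, `γ₃⁰ = 0`,
`δ₁ = δ₂ ⊕ δ₃⁰`, and `α₁ ≠ α₂`. -/
theorem anf_restrictions_for_y0_eq_zero
    (α₁ β₁ γ₁ δ₁ α₂ β₂ γ₂ δ₂ α₃ β₃ γ₃ δ₃ : Bool)
    (h : ∀ x10 x11 x20 x21 : Bool, x10 = x20 →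
      ganf α₃ β₃ γ₃ δ₃ (ganf α₁ β₁ γ₁ δ₁ x10 x11) (ganf α₂ β₂ γ₂ δ₂ x20 x21)
        = xor (xor x11 x21) (x10 || x20)) :
    α₃ = true ∧ β₃ = true ∧ γ₃ = false ∧ δ₁ = xor δ₂ δ₃ ∧ α₁ ≠ α₂ := by
  obtain ⟨rfl, rfl, rfl, rfl⟩ := ganf_coeffs_of_eq_xor β₁ δ₁ β₂ δ₂ α₃ β₃ γ₃ δ₃
    fun a b => by simpa [ganf] using h false a false b rfl
  refine ⟨rfl, rfl, rfl, rfl, ?_⟩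
  rintro rfl
  have h1 := h true false true false rfl
  cases α₁ <;> cases δ₂ <;> cases δ₃ <;> simp [ganf] at h1
end
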